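/- Let T be a finite rooted binary tree with leaf assignment χ and maximum path decomposition P_max(T), let U be a connected component of the shrub forest of unsupported short paths with root r = r(U). Suppose that for all q, q' ∈ U \ {r} with q the parent of q' in U we have W_q ≥ (4/3)·W_{q'}. Then Σ_{p ∈ U} |p| ≤ W_r/20 + |r|. -/

import Mathlib

open scoped Classical
noncomputable section

/-- A finite rooted binary tree on vertex set `V`: every non-root vertex has a parent,
the root has none, depths are consistent (ensuring acyclicity), and each vertex has
at most two children. -/
structure RBTree (V : Type) [Fintype V] [DecidableEq V] where
  parent : V → Option V
  root : V
  depth : V → ℕ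
  parent_root : parent root = none
  root_of_parent_none : ∀ v, parent v = none → v = root
  depth_parent : ∀ v u, parent v = some u → depth v = depth u + 1
  binary : ∀ v : V, (Finset.univ.filter (fun c => parent c = some v)).card ≤ 2

namespace RBTree

variable {V : Type} [Fintype V] [DecidableEq V]

/-- The children of a vertex. -/
def children (T : RBTree V) (v : V) : Finset V :=
  Finset.univ.filter (fun c => T.parent c = some v)

/-- A leaf is a vertex with no children. -/
def IsLeaf (T : RBTree V) (v : V) : Prop := T.children v = ∅

/-- Iterated parent map. -/
def parentIter (T : RBTree V) : ℕ → V → Option V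
  | 0, v => some v
  | n + 1, v => (T.parentIter n v).bind T.parent

/-- `u` is a (weak) ancestor of `v`: `u` lies on the path from `v` to the root
(including `v` itself). -/
def Anc (T : RBTree V) (u v : V) : Prop := ∃ n, T.parentIter n v = some u

/-- `u` is a strict ancestor of `v`. -/
def StrictAnc (T : RBTree V) (u v : V) : Prop := ∃ n, 0 < n ∧ T.parentIter n v = some u

/-- `L(T_v)`: the leaves of the subtree rooted at `v`. -/
def subtreeLeaves (T : RBTree V) (v : V) : Finset V :=
  Finset.univ.filter (fun l => T.IsLeaf l ∧ T.Anc v l)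

/-- A leaf assignment `χ` assigns to each internal vertex a set of leaves containing
exactly one leaf from the subtree of each of its children (and nothing else);
leaves are assigned the empty set. -/
structure LeafAssignment (T : RBTree V) where
  χ : V → Finset V
  mem_leaf : ∀ v l, l ∈ χ v → T.IsLeaf l
  mem_desc : ∀ v l, l ∈ χ v → ∃ c ∈ T.children v, T.Anc c l
  unique_child : ∀ v, ∀ c ∈ T.children v, ∃! l, l ∈ χ v ∧ T.Anc c l

/-- The heap `H_v = {u ∈ A(v) : χ(u) ∩ L(T_v) ≠ ∅}` of a vertex `v`. -/
def heap (T : RBTree V) (A : T.LeafAssignment) (v : V) : Finset V :=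
  Finset.univ.filter (fun u => T.StrictAnc u v ∧ (A.χ u ∩ T.subtreeLeaves v).Nonempty)

/-- A leaf path: the set of vertices on a monotone path from some leaf `ℓ` up to an
ancestor `b` of `ℓ`. -/
def IsLeafPath (T : RBTree V) (p : Finset V) : Prop :=
  ∃ ℓ b, T.IsLeaf ℓ ∧ T.Anc b ℓ ∧
    p = Finset.univ.filter (fun u => T.Anc u ℓ ∧ T.Anc b u)

/-- The base `b(p)` of a path: its vertex closest to the root. -/
def base (T : RBTree V) (p : Finset V) : V :=
  if h : ∃ b, b ∈ p ∧ ∀ w ∈ p, T.Anc b w then h.choose else T.root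

/-- The leaf `ℓ(p)` of a path. -/
def pathLeaf (T : RBTree V) (p : Finset V) : V :=
  if h : ∃ l, l ∈ p ∧ ∀ w ∈ p, T.Anc w l then h.choose else T.root

/-- `H_p = H_{b(p)}`. -/
def pathHeap (T : RBTree V) (A : T.LeafAssignment) (p : Finset V) : Finset V :=
  T.heap A (T.base p)

/-- A path decomposition: a partition of the vertex set into leaf paths. -/
def IsPathDecomp (T : RBTree V) (P : Finset (Finset V)) : Prop :=
  (∀ p ∈ P, T.IsLeafPath p) ∧ (∀ v : V, ∃! p, p ∈ P ∧ v ∈ p)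

/-- `q` is a child of `p` in the shrub: the parent of `b(q)` lies on `p`. -/
def ShrubParent (T : RBTree V) (p q : Finset V) : Prop :=
  ∃ u, T.parent (T.base q) = some u ∧ u ∈ p

/-- `p` is a strict ancestor of `q` in the shrub: some vertex of `p` is a strict
ancestor of `b(q)` in `T` (and `p ≠ q`). -/
def ShrubStrictAnc (T : RBTree V) (p q : Finset V) : Prop :=
  p ≠ q ∧ ∃ u ∈ p, T.StrictAnc u (T.base q)

/-- Weak ancestor relation in the shrub. -/
def ShrubAnc (T : RBTree V) (p q : Finset V) : Prop :=
  p = q ∨ T.ShrubStrictAnc p q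

/-- A maximum path decomposition w.r.t. a leaf assignment: a path decomposition in
which each internal vertex lies on the same path as a child of maximal heap size. -/
def IsMaxPathDecomp (T : RBTree V) (A : T.LeafAssignment) (P : Finset (Finset V)) : Prop :=
  T.IsPathDecomp P ∧
    ∀ p ∈ P, ∀ v ∈ p, ∀ c ∈ T.children v, c ∈ p →
      ∀ c' ∈ T.children v, (T.heap A c').card ≤ (T.heap A c).card

/-- A path `p` is short if `|p| < sqrt(|H_p|)/100`. -/
def IsShort (T : RBTree V) (A : T.LeafAssignment) (p : Finset V) : Prop :=
  (p.card : ℝ) < Real.sqrt ((T.pathHeap A p).card) / 100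

/-- The tall support chain of a path `p`: the maximal chain of tall paths in the shrub
starting at the parent of `p` and going up. -/
def TallChain (T : RBTree V) (A : T.LeafAssignment) (P : Finset (Finset V)) (p : Finset V) :
    Finset (Finset V) :=
  P.filter (fun q => T.ShrubStrictAnc q p ∧
    ∀ r ∈ P, T.ShrubStrictAnc r p → T.ShrubAnc q r → ¬ T.IsShort A r)

/-- A short path is supported if at least `|H_p|/100` of the vertices of `H_p` lie on
paths of its tall support chain. -/
def IsSupported (T : RBTree V) (A : T.LeafAssignment) (P : Finset (Finset V))
    (p : Finset V) : Prop :=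
  ((T.pathHeap A p).card : ℝ) / 100 ≤
    (((T.pathHeap A p).filter (fun v => ∃ q ∈ T.TallChain A P p, v ∈ q)).card : ℝ)

/-- The reduced heap `H̃_p`: vertices of `H_p` not lying on the tall support chain. -/
def redHeap (T : RBTree V) (A : T.LeafAssignment) (P : Finset (Finset V))
    (p : Finset V) : Finset V :=
  (T.pathHeap A p).filter (fun v => ∀ q ∈ T.TallChain A P p, v ∉ q)

/-- `q` is the parent of the unsupported short path `p` in the shrub forest of
unsupported short paths: `q` is the first short path on the chain of strict shrub
ancestors of `p`. -/
def ForestParent (T : RBTree V) (A : T.LeafAssignment) (P : Finset (Finset V))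
    (q p : Finset V) : Prop :=
  q ∈ P ∧ p ∈ P ∧ T.IsShort A q ∧ T.IsShort A p ∧ ¬ T.IsSupported A P p ∧
    T.ShrubStrictAnc q p ∧
    ∀ r ∈ P, T.ShrubStrictAnc r p → T.ShrubStrictAnc q r → ¬ T.IsShort A r

/-- `U` is the connected component of the shrub forest of unsupported short paths
rooted at the supported short path `r`. -/
def IsComponent (T : RBTree V) (A : T.LeafAssignment) (P : Finset (Finset V))
    (U : Finset (Finset V)) (r : Finset V) : Prop :=
  U ⊆ P ∧ r ∈ U ∧ T.IsShort A r ∧ T.IsSupported A P r ∧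
    (∀ p ∈ U, T.IsShort A p) ∧
    (∀ p ∈ U, p ≠ r → ¬ T.IsSupported A P p) ∧
    (∀ p ∈ U, p ≠ r → ∃ q ∈ U, T.ForestParent A P q p) ∧
    (∀ q ∈ U, ∀ p ∈ P, T.ForestParent A P q p → p ∈ U)

/-- `q` lies in the subtree of the shrub forest rooted at `p`. -/
def ForestDesc (T : RBTree V) (A : T.LeafAssignment) (P : Finset (Finset V))
    (p q : Finset V) : Prop :=
  Relation.ReflTransGen (fun a b => T.ForestParent A P a b) p q

/-- `U_p`: the nodes of `U` in the subtree of the shrub forest rooted at `p`. -/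
def usub (T : RBTree V) (A : T.LeafAssignment) (P : Finset (Finset V))
    (U : Finset (Finset V)) (p : Finset V) : Finset (Finset V) :=
  U.filter (fun q => T.ForestDesc A P p q)

/-- The children of `p` in the shrub forest (within `U`). -/
def forestChildren (T : RBTree V) (A : T.LeafAssignment) (P : Finset (Finset V))
    (U : Finset (Finset V)) (p : Finset V) : Finset (Finset V) :=
  U.filter (fun q => T.ForestParent A P p q)

/-- The residue `R_p = |H̃_p| − Σ_{q child of p} |H̃_q|`. -/
def residue (T : RBTree V) (A : T.LeafAssignment) (P : Finset (Finset V))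
    (U : Finset (Finset V)) (p : Finset V) : ℤ :=
  ((T.redHeap A P p).card : ℤ) -
    ∑ q ∈ T.forestChildren A P U p, ((T.redHeap A P q).card : ℤ)

/-- `R⁺_p = max(R_p, 0)`. -/
def resPlus (T : RBTree V) (A : T.LeafAssignment) (P : Finset (Finset V))
    (U : Finset (Finset V)) (p : Finset V) : ℤ :=
  max (T.residue A P U p) 0

/-- The weight `W_p = Σ_{q ∈ U_p} R⁺_q`. -/
def weight (T : RBTree V) (A : T.LeafAssignment) (P : Finset (Finset V))
    (U : Finset (Finset V)) (p : Finset V) : ℤ :=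
  ∑ q ∈ T.usub A P U p, T.resPlus A P U q

end RBTree

namespace RBTree

variable {V : Type} [Fintype V] [DecidableEq V]

lemma parentIter_add (T : RBTree V) (m n : ℕ) (v : V) :
    T.parentIter (m + n) v = (T.parentIter n v).bind (T.parentIter m) := by
  induction m with
  | zero => cases h : T.parentIter n v <;> simp [parentIter, h]
  | succ m ih =>
    rw [Nat.succ_add]
    simp only [parentIter, ih]
    cases T.parentIter n v <;> simp

lemma depth_parentIter (T : RBTree V) {n : ℕ} {v u : V} (h : T.parentIter n v = some u) :
    T.depth v = T.depth u + n := by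
  induction n generalizing u with
  | zero => simp_all [parentIter]
  | succ n ih =>
    simp only [parentIter, Option.bind_eq_some_iff] at h
    obtain ⟨w, hw, hwu⟩ := h
    have h1 := ih hw
    have h2 := T.depth_parent w u hwu
    omega

lemma Anc.trans {T : RBTree V} {a b c : V} (hab : T.Anc a b) (hbc : T.Anc b c) :
    T.Anc a c := by
  obtain ⟨m, hm⟩ := hab
  obtain ⟨n, hn⟩ := hbc
  exact ⟨m + n, by rw [parentIter_add, hn]; exact hm⟩

lemma Anc.depth_le {T : RBTree V} {a b : V} (h : T.Anc a b) : T.depth a ≤ T.depth b := by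
  obtain ⟨n, hn⟩ := h
  have := T.depth_parentIter hn
  omega

lemma Anc.strictAnc_of_ne {T : RBTree V} {a b : V} (h : T.Anc a b) (hne : a ≠ b) :
    T.StrictAnc a b := by
  obtain ⟨n, hn⟩ := h
  refine ⟨n, Nat.pos_of_ne_zero ?_, hn⟩
  rintro rfl
  simp only [parentIter, Option.some.injEq] at hn
  exact hne hn.symm

lemma StrictAnc.anc {T : RBTree V} {a b : V} (h : T.StrictAnc a b) : T.Anc a b :=
  h.imp fun _ hn => hn.2

lemma StrictAnc.depth_lt {T : RBTree V} {a b : V} (h : T.StrictAnc a b) :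
    T.depth a < T.depth b := by
  obtain ⟨n, h0, hn⟩ := h
  have := T.depth_parentIter hn
  omega

lemma Anc.total {T : RBTree V} {a b v : V} (ha : T.Anc a v) (hb : T.Anc b v) :
    T.Anc a b ∨ T.Anc b a := by
  obtain ⟨m, hm⟩ := ha
  obtain ⟨n, hn⟩ := hb
  rcases le_total m n with h | h <;> obtain ⟨k, rfl⟩ := Nat.exists_eq_add_of_le' h
  · rw [parentIter_add, hm] at hn
    exact Or.inr ⟨k, hn⟩
  · rw [parentIter_add, hn] at hm
    exact Or.inl ⟨k, hm⟩

lemma IsLeafPath.base_spec {T : RBTree V} {p : Finset V} (hp : T.IsLeafPath p) :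
    T.base p ∈ p ∧ ∀ w ∈ p, T.Anc (T.base p) w := by
  have h : ∃ b, b ∈ p ∧ ∀ w ∈ p, T.Anc b w := by
    obtain ⟨l, b, -, hb, rfl⟩ := hp
    refine ⟨b, ?_, fun w hw => (Finset.mem_filter.1 hw).2.2⟩
    exact Finset.mem_filter.2 ⟨Finset.mem_univ _, hb, 0, rfl⟩
  rw [base, dif_pos h]
  exact h.choose_spec

lemma IsLeafPath.mem_of_anc {T : RBTree V} {p : Finset V} (hp : T.IsLeafPath p) {a x c : V}
    (ha : a ∈ p) (hc : c ∈ p) (hax : T.Anc a x) (hxc : T.Anc x c) : x ∈ p := by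
  obtain ⟨l, b, -, -, rfl⟩ := hp
  simp only [Finset.mem_filter, Finset.mem_univ, true_and] at ha hc ⊢
  exact ⟨hxc.trans hc.1, ha.2.trans hax⟩

lemma ForestParent.depth_base_lt {T : RBTree V} {A : T.LeafAssignment}
    {P : Finset (Finset V)} (hP : T.IsPathDecomp P) {q p : Finset V}
    (h : T.ForestParent A P q p) : T.depth (T.base q) < T.depth (T.base p) := by
  obtain ⟨hq, -, -, -, -, ⟨-, u, hu, hup⟩, -⟩ := h
  exact (((hP.1 q hq).base_spec.2 u hu).depth_le).trans_lt hup.depth_lt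

lemma ForestDesc.depth_base_le {T : RBTree V} {A : T.LeafAssignment}
    {P : Finset (Finset V)} (hP : T.IsPathDecomp P) {q p : Finset V}
    (h : T.ForestDesc A P q p) : T.depth (T.base q) ≤ T.depth (T.base p) := by
  induction h with
  | refl => exact le_rfl
  | tail _ h ih => exact ih.trans (h.depth_base_lt hP).le

lemma shrubStrictAnc_of_anc {T : RBTree V} {P : Finset (Finset V)} (hP : T.IsPathDecomp P)
    {q q' : Finset V} (hq : q ∈ P) (hq' : q' ∈ P) (hne : q ≠ q') {u u' : V} (hu : u ∈ q)
    (hu' : u' ∈ q') (h : T.Anc u u') : T.ShrubStrictAnc q q' := by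
  have hnot : u ∉ q' := fun hmem => hne ((hP.2 u).unique ⟨hq, hu⟩ ⟨hq', hmem⟩)
  obtain ⟨hb, hbase⟩ := (hP.1 q' hq').base_spec
  have hub : T.Anc u (T.base q') := by
    rcases h.total (hbase u' hu') with h1 | h1
    · exact h1
    · exact absurd ((hP.1 q' hq').mem_of_anc hb hu' h1 h) hnot
  exact ⟨hne, u, hu, hub.strictAnc_of_ne fun e => hnot (e ▸ hb)⟩

lemma ForestParent.left_unique {T : RBTree V} {A : T.LeafAssignment}
    {P : Finset (Finset V)} (hP : T.IsPathDecomp P) {q q' p : Finset V}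
    (h : T.ForestParent A P q p) (h' : T.ForestParent A P q' p) : q = q' := by
  by_contra hne
  obtain ⟨hq, -, hqs, -, -, hqp, hmin⟩ := h
  obtain ⟨hq', -, hqs', -, -, hqp', hmin'⟩ := h'
  obtain ⟨-, u, hu, hup⟩ := id hqp
  obtain ⟨-, u', hu', hup'⟩ := id hqp'
  rcases hup.anc.total hup'.anc with h1 | h1
  · exact hmin q' hq' hqp' (shrubStrictAnc_of_anc hP hq hq' hne hu hu' h1) hqs'
  · exact hmin' q hq hqp (shrubStrictAnc_of_anc hP hq' hq (Ne.symm hne) hu' hu h1) hqs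

lemma usub_disjoint {T : RBTree V} {A : T.LeafAssignment} {P : Finset (Finset V)}
    (hP : T.IsPathDecomp P) (U : Finset (Finset V)) {p c c' : Finset V}
    (hc : T.ForestParent A P p c) (hc' : T.ForestParent A P p c') (hne : c ≠ c') :
    Disjoint (T.usub A P U c) (T.usub A P U c') := by
  have key : ∀ {a b : Finset V}, T.ForestParent A P p a → T.ForestParent A P p b →
      T.ForestDesc A P a b → a = b := by
    intro a b ha hb hab
    rcases Relation.ReflTransGen.cases_tail hab with h | ⟨m, ham, hmb⟩
    · exact h.symm
    · obtain rfl := hmb.left_unique hP hb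
      have h1 := ForestDesc.depth_base_le hP ham
      have h2 := ha.depth_base_lt hP
      omega
  rw [Finset.disjoint_left]
  intro q hq hq'
  have h1 := Relation.reflTransGen_swap.2 (Finset.mem_filter.1 hq).2
  have h2 := Relation.reflTransGen_swap.2 (Finset.mem_filter.1 hq').2
  have hU : Relator.RightUnique (Function.swap fun a b => T.ForestParent A P a b) :=
    fun _ _ _ ha hb => ForestParent.left_unique hP ha hb
  rcases Relation.ReflTransGen.total_of_right_unique hU h1 h2 with h | h
  · exact hne (key hc' hc (Relation.reflTransGen_swap.1 h)).symm
  · exact hne (key hc hc' (Relation.reflTransGen_swap.1 h))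

lemma sum_usub {T : RBTree V} {A : T.LeafAssignment} {P : Finset (Finset V)}
    (hP : T.IsPathDecomp P) {U : Finset (Finset V)}
    (hclosed : ∀ q ∈ U, ∀ p ∈ P, T.ForestParent A P q p → p ∈ U)
    {M : Type*} [AddCommMonoid M] (f : Finset V → M) {p : Finset V} (hp : p ∈ U) :
    ∑ q ∈ T.usub A P U p, f q =
      f p + ∑ c ∈ T.forestChildren A P U p, ∑ q ∈ T.usub A P U c, f q := by
  have hdecomp : T.usub A P U p =
      insert p ((T.forestChildren A P U p).biUnion (T.usub A P U)) := by
    ext q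
    simp only [usub, forestChildren, Finset.mem_insert, Finset.mem_biUnion, Finset.mem_filter]
    constructor
    · rintro ⟨hq, hpq⟩
      rcases Relation.ReflTransGen.cases_head hpq with h | ⟨c, hpc, hcq⟩
      · exact Or.inl h.symm
      · exact Or.inr ⟨c, ⟨hclosed p hp c hpc.2.1 hpc, hpc⟩, hq, hcq⟩
    · rintro (rfl | ⟨c, ⟨-, hpc⟩, hq, hcq⟩)
      · exact ⟨hp, Relation.ReflTransGen.refl⟩
      · exact ⟨hq, Relation.ReflTransGen.head hpc hcq⟩
  have hnot : p ∉ (T.forestChildren A P U p).biUnion (T.usub A P U) := by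
    simp only [usub, forestChildren, Finset.mem_biUnion, Finset.mem_filter]
    rintro ⟨c, ⟨-, hpc⟩, -, hcp⟩
    have h1 := ForestDesc.depth_base_le hP hcp
    have h2 := hpc.depth_base_lt hP
    omega
  rw [hdecomp, Finset.sum_insert hnot, Finset.sum_biUnion]
  intro c hc c' hc' hne
  exact usub_disjoint hP U (Finset.mem_filter.1 hc).2 (Finset.mem_filter.1 hc').2 hne

lemma card_usub_lt {T : RBTree V} {A : T.LeafAssignment} {P : Finset (Finset V)}
    (hP : T.IsPathDecomp P) {U : Finset (Finset V)}
    (hclosed : ∀ q ∈ U, ∀ p ∈ P, T.ForestParent A P q p → p ∈ U)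
    {p c : Finset V} (hp : p ∈ U) (hc : c ∈ T.forestChildren A P U p) :
    (T.usub A P U c).card < (T.usub A P U p).card := by
  have h := sum_usub hP hclosed (fun _ => 1) hp
  simp only [← Finset.card_eq_sum_ones] at h
  have := Finset.single_le_sum (f := fun c => (T.usub A P U c).card)
    (fun _ _ => Nat.zero_le _) hc
  omega

/-- Induction over a component, from the children of a path to the path itself. -/
lemma forest_induction {T : RBTree V} {A : T.LeafAssignment} {P : Finset (Finset V)}
    (hP : T.IsPathDecomp P) {U : Finset (Finset V)}
    (hclosed : ∀ q ∈ U, ∀ p ∈ P, T.ForestParent A P q p → p ∈ U)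
    {motive : Finset V → Prop}
    (step : ∀ p ∈ U, (∀ c ∈ T.forestChildren A P U p, motive c) → motive p) :
    ∀ p ∈ U, motive p := by
  intro p
  induction hn : (T.usub A P U p).card using Nat.strong_induction_on generalizing p with
  | _ n ih =>
    subst hn
    intro hp
    exact step p hp fun c hc =>
      ih _ (card_usub_lt hP hclosed hp hc) c rfl (Finset.mem_filter.1 hc).1

lemma redHeap_card_le_weight {T : RBTree V} {A : T.LeafAssignment} {P : Finset (Finset V)}
    (hP : T.IsPathDecomp P) {U : Finset (Finset V)}
    (hclosed : ∀ q ∈ U, ∀ p ∈ P, T.ForestParent A P q p → p ∈ U) :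
    ∀ p ∈ U, ((T.redHeap A P p).card : ℤ) ≤ T.weight A P U p := by
  refine forest_induction hP hclosed fun p hp ih => ?_
  have h1 := Finset.sum_le_sum ih
  have h2 : T.residue A P U p ≤ T.resPlus A P U p := le_max_left _ _
  rw [weight, sum_usub hP hclosed _ hp]
  simp only [residue] at h2
  simp only [weight] at h1
  linarith

lemma redHeap_card_of_not_isSupported {T : RBTree V} {A : T.LeafAssignment}
    {P : Finset (Finset V)} {p : Finset V} (h : ¬ T.IsSupported A P p) :
    (99 / 100 : ℝ) * (T.pathHeap A p).card ≤ (T.redHeap A P p).card := by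
  have h1 := Finset.card_filter_add_card_filter_not (s := T.pathHeap A p)
    (fun v => ∃ q ∈ T.TallChain A P p, v ∈ q)
  have h2 : (T.redHeap A P p) =
      (T.pathHeap A p).filter (fun v => ¬ ∃ q ∈ T.TallChain A P p, v ∈ q) := by
    simp [redHeap]
  rw [← h2] at h1
  rw [IsSupported, not_le] at h
  have h3 : (((T.pathHeap A p).filter (fun v => ∃ q ∈ T.TallChain A P p, v ∈ q)).card : ℝ) +
    (T.redHeap A P p).card = (T.pathHeap A p).card := by exact_mod_cast h1
  linarith

lemma card_le_sqrt_weight {T : RBTree V} {A : T.LeafAssignment} {P : Finset (Finset V)}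
    (hP : T.IsPathDecomp P) {U : Finset (Finset V)} (hUP : U ⊆ P)
    (hclosed : ∀ q ∈ U, ∀ p ∈ P, T.ForestParent A P q p → p ∈ U) {p : Finset V} (hp : p ∈ U)
    (hs : T.IsShort A p) (hu : ¬ T.IsSupported A P p) :
    (p.card : ℝ) ≤ √(T.weight A P U p) / 99 ∧ (99 : ℝ) ≤ √(T.weight A P U p) := by
  have hcard : (1 : ℝ) ≤ p.card := by
    exact_mod_cast Finset.card_pos.2 ⟨_, (hP.1 p (hUP hp)).base_spec.1⟩
  have hW : ((T.redHeap A P p).card : ℝ) ≤ T.weight A P U p := by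
    exact_mod_cast redHeap_card_le_weight hP hclosed p hp
  have hH := redHeap_card_of_not_isSupported hu
  rw [IsShort] at hs
  have hh : (0 : ℝ) ≤ (T.pathHeap A p).card := Nat.cast_nonneg _
  have hsq : 99 / 100 * √((T.pathHeap A p).card) ≤ √(T.weight A P U p) := by
    apply Real.le_sqrt_of_sq_le
    rw [mul_pow, Real.sq_sqrt hh]
    linarith
  constructor <;> linarith

lemma weight_nonneg (T : RBTree V) (A : T.LeafAssignment) (P U : Finset (Finset V))
    (p : Finset V) : 0 ≤ T.weight A P U p :=
  Finset.sum_nonneg fun _ _ => le_max_right _ _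

lemma sum_weight_le {T : RBTree V} {A : T.LeafAssignment} {P : Finset (Finset V)}
    (hP : T.IsPathDecomp P) {U : Finset (Finset V)}
    (hclosed : ∀ q ∈ U, ∀ p ∈ P, T.ForestParent A P q p → p ∈ U) {p : Finset V} (hp : p ∈ U) :
    ∑ c ∈ T.forestChildren A P U p, (T.weight A P U c : ℝ) ≤ T.weight A P U p := by
  have h := sum_usub hP hclosed (T.resPlus A P U) hp
  have h0 : 0 ≤ T.resPlus A P U p := le_max_right _ _
  have : ∑ c ∈ T.forestChildren A P U p, T.weight A P U c ≤ T.weight A P U p := by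
    simp only [weight]
    linarith
  exact_mod_cast this

/-- The inductive step of the charging argument: a term `√W / 99` is absorbed when the weight
`W` splits into parts that are each at most `3 / 4` of it. -/
lemma charge_step {ι : Type*} (s : Finset ι) (w : ι → ℝ) {W : ℝ} (hw : ∀ i ∈ s, 0 ≤ w i)
    (hgeo : ∀ i ∈ s, 4 / 3 * w i ≤ W) (hsum : ∑ i ∈ s, w i ≤ W) (hW : 99 ≤ √W) :
    √W / 99 + ∑ i ∈ s, (w i / 20 - 7 / 100 * √(w i)) ≤ W / 20 - 7 / 100 * √W := by
  have hW0 : 0 ≤ W := (Finset.sum_nonneg hw).trans hsum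
  have hpos : 0 < √W := by linarith
  have hterm : ∀ i ∈ s, 1154 / 1000 * w i / √W ≤ √(w i) := by
    intro i hi
    rw [div_le_iff₀ hpos, ← Real.sqrt_mul (hw i hi)]
    apply Real.le_sqrt_of_sq_le
    nlinarith [mul_le_mul_of_nonneg_left (hgeo i hi) (hw i hi), sq_nonneg (w i)]
  have hterms := Finset.sum_le_sum hterm
  rw [← Finset.sum_div, ← Finset.mul_sum] at hterms
  rw [Finset.sum_sub_distrib, ← Finset.sum_div, ← Finset.mul_sum]
  have hsq : √W * √W = W := Real.mul_self_sqrt hW0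
  rw [div_le_iff₀ hpos] at hterms
  refine le_of_mul_le_mul_right ?_ hpos
  nlinarith [mul_nonneg (sub_nonneg.2 hsum) (sub_nonneg.2 hW)]

lemma sum_card_usub_le {T : RBTree V} {A : T.LeafAssignment} {P : Finset (Finset V)}
    (hP : T.IsPathDecomp P) {U : Finset (Finset V)} {r : Finset V}
    (hU : T.IsComponent A P U r)
    (hgeo : ∀ q ∈ U, q ≠ r → ∀ q' ∈ U, q' ≠ r → T.ForestParent A P q q' →
      (4 / 3 : ℝ) * (T.weight A P U q' : ℝ) ≤ (T.weight A P U q : ℝ)) :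
    ∀ p ∈ U, p ≠ r → ∑ q ∈ T.usub A P U p, (q.card : ℝ) ≤
      (T.weight A P U p : ℝ) / 20 - 7 / 100 * √(T.weight A P U p) := by
  obtain ⟨hUP, -, -, hsupp, hshort, hunsupp, -, hclosed⟩ := hU
  refine forest_induction hP hclosed fun p hp ih hpr => ?_
  obtain ⟨h1, h2⟩ :=
    card_le_sqrt_weight hP hUP hclosed hp (hshort p hp) (hunsupp p hp hpr)
  have hne : ∀ c ∈ T.forestChildren A P U p, c ≠ r := by
    rintro c hc rfl
    exact (Finset.mem_filter.1 hc).2.2.2.2.2.1 hsupp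
  have hstep := charge_step (T.forestChildren A P U p) (fun c => (T.weight A P U c : ℝ))
    (fun c _ => by exact_mod_cast T.weight_nonneg A P U c)
    (fun c hc => hgeo p hp hpr c (Finset.mem_filter.1 hc).1 (hne c hc)
      (Finset.mem_filter.1 hc).2)
    (sum_weight_le hP hclosed hp) h2
  have hsum := Finset.sum_le_sum fun c hc => ih c hc (hne c hc)
  rw [sum_usub hP hclosed _ hp]
  linarith

lemma IsComponent.usub_root {T : RBTree V} {A : T.LeafAssignment} {P : Finset (Finset V)}
    (hP : T.IsPathDecomp P) {U : Finset (Finset V)} {r : Finset V}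
    (hU : T.IsComponent A P U r) : T.usub A P U r = U := by
  obtain ⟨-, -, -, -, -, -, hparent, -⟩ := hU
  refine Finset.filter_true_of_mem fun p => ?_
  induction hn : T.depth (T.base p) using Nat.strong_induction_on generalizing p with
  | _ n ih =>
    subst hn
    intro hp
    by_cases hpr : p = r
    · subst hpr
      exact Relation.ReflTransGen.refl
    · obtain ⟨q, hq, hqp⟩ := hparent p hp hpr
      exact Relation.ReflTransGen.tail (ih _ (hqp.depth_base_lt hP) q rfl hq) hqp

end RBTree

open RBTree in
/-- for a connected component `U` of the shrub forest of unsupported short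
paths of a maximum path decomposition, with root `r = r(U)`, if `W_q ≥ (4/3)·W_{q'}`
whenever `q` is the parent of `q'` in `U` with `q, q' ∈ U \ {r}`, then
`Σ_{p ∈ U} |p| ≤ W_r/20 + |r|`. -/
theorem charge_sum_le_weight_root {V : Type} [Fintype V] [DecidableEq V]
    (T : RBTree V) (A : T.LeafAssignment) (P : Finset (Finset V))
    (hP : T.IsMaxPathDecomp A P) (U : Finset (Finset V)) (r : Finset V)
    (hU : T.IsComponent A P U r)
    (hgeo : ∀ q ∈ U, q ≠ r → ∀ q' ∈ U, q' ≠ r → T.ForestParent A P q q' →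
      (4 / 3 : ℝ) * (T.weight A P U q' : ℝ) ≤ (T.weight A P U q : ℝ)) :
    (∑ p ∈ U, (p.card : ℝ)) ≤ (T.weight A P U r : ℝ) / 20 + (r.card : ℝ) := by
  have hPD := hP.1
  have hroot := hU.usub_root hPD
  have hbound := sum_card_usub_le hPD hU hgeo
  obtain ⟨-, hr, -, hsupp, -, -, -, hclosed⟩ := hU
  have hchild : ∀ c ∈ T.forestChildren A P U r,
      ∑ q ∈ T.usub A P U c, (q.card : ℝ) ≤ (T.weight A P U c : ℝ) / 20 := by
    intro c hc
    have hcr : c ≠ r := by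
      rintro rfl
      exact (Finset.mem_filter.1 hc).2.2.2.2.2.1 hsupp
    have := hbound c (Finset.mem_filter.1 hc).1 hcr
    linarith [Real.sqrt_nonneg (T.weight A P U c : ℝ)]
  have hsum := Finset.sum_le_sum hchild
  rw [← Finset.sum_div] at hsum
  have hW := sum_weight_le hPD hclosed hr
  have hsplit := sum_usub hPD hclosed (fun q : Finset V => (q.card : ℝ)) hr
  rw [hroot] at hsplit
  linarith
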